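/- Let h: [0,∞) → [0,∞) be of class C² with h(0) = h'(0) = 0 and suppose there are constants c₁, c₂ > 0 and an exponent μ ∈ (1,∞) such that c₁(1+t)^{−μ} ≤ min{h''(t), h'(t)/t} and max{h''(t), h'(t)/t} ≤ c₂/(1+t) for all t ≥ 0. Suppose u ∈ C¹(ℝ², ℝ²) is divergence-free, bounded, and a weak solution of the stationary generalized Navier–Stokes system with dissipative potential H(ε) = h(|ε|). Then there exists a constant c < ∞, depending only on sup_{ℝ²}|u|, h and the constants c₁, c₂, μ, such that for every x₀ ∈ ℝ² and every R > 0, ∫_{Q_R(x₀)} h(|ε(u)|) dx ≤ c·R, where Q_R(x₀) := {x ∈ ℝ² : |x₁ − x₀₁| < R and |x₂ − x₀₂| < R}. -/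

import Mathlib

noncomputable section

open MeasureTheory Real Filter

/-- Partial derivative ∂ₖu(x) ∈ ℝⁿ of a vector field u : ℝⁿ → ℝⁿ. -/
def pd {n : ℕ} (u : EuclideanSpace ℝ (Fin n) → EuclideanSpace ℝ (Fin n))
    (k : Fin n) (x : EuclideanSpace ℝ (Fin n)) : EuclideanSpace ℝ (Fin n) :=
  fderiv ℝ u x (EuclideanSpace.single k 1)

/-- Divergence of u at x. -/
def divg {n : ℕ} (u : EuclideanSpace ℝ (Fin n) → EuclideanSpace ℝ (Fin n))
    (x : EuclideanSpace ℝ (Fin n)) : ℝ :=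
  ∑ k, pd u k x k

/-- Symmetric gradient ε(u)(x) = (1/2)(∇u + (∇u)ᵀ), entry (i,j) = (∂ⱼuⁱ + ∂ᵢuʲ)/2. -/
def symGrad {n : ℕ} (u : EuclideanSpace ℝ (Fin n) → EuclideanSpace ℝ (Fin n))
    (x : EuclideanSpace ℝ (Fin n)) : Matrix (Fin n) (Fin n) ℝ :=
  fun i j => (pd u j x i + pd u i x j) / 2

/-- Full gradient ∇u(x), entry (i,j) = ∂ⱼuⁱ. -/
def gradM {n : ℕ} (u : EuclideanSpace ℝ (Fin n) → EuclideanSpace ℝ (Fin n))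
    (x : EuclideanSpace ℝ (Fin n)) : Matrix (Fin n) (Fin n) ℝ :=
  fun i j => pd u j x i

/-- Frobenius inner product A : B. -/
def frob {n : ℕ} (A B : Matrix (Fin n) (Fin n) ℝ) : ℝ := ∑ i, ∑ j, A i j * B i j

/-- Frobenius norm |A|. -/
def fnorm {n : ℕ} (A : Matrix (Fin n) (Fin n) ℝ) : ℝ := Real.sqrt (frob A A)

/-- DH(ε) = (h'(|ε|)/|ε|) ε, interpreted as 0 at ε = 0. -/
def DH {n : ℕ} (h : ℝ → ℝ) (A : Matrix (Fin n) (Fin n) ℝ) : Matrix (Fin n) (Fin n) ℝ :=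
  if fnorm A = 0 then 0 else (deriv h (fnorm A) / fnorm A) • A

/-- u is a weak solution of -div DH(ε(u)) + (u·∇)u + ∇π = 0, div u = 0:
for all smooth compactly supported divergence-free φ,
∫ DH(ε(u)) : ε(φ) dx + ∫ uᵏ ∂ₖuⁱ φⁱ dx = 0. -/
def IsWeakSolution {n : ℕ} (h : ℝ → ℝ)
    (u : EuclideanSpace ℝ (Fin n) → EuclideanSpace ℝ (Fin n)) : Prop :=
  ∀ φ : EuclideanSpace ℝ (Fin n) → EuclideanSpace ℝ (Fin n),
    ContDiff ℝ (⊤ : ℕ∞) φ → HasCompactSupport φ → (∀ x, divg φ x = 0) →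
    (∫ x, frob (DH h (symGrad u x)) (symGrad φ x)) +
      (∫ x, ∑ k, ∑ i, u x k * pd u k x i * φ x i) = 0

/-- u is a weak solution of the Stokes-type system -div DH(ε(u)) + ∇π = 0, div u = 0:
for all smooth compactly supported divergence-free φ, ∫ DH(ε(u)) : ε(φ) dx = 0. -/
def IsStokesWeakSolution {n : ℕ} (h : ℝ → ℝ)
    (u : EuclideanSpace ℝ (Fin n) → EuclideanSpace ℝ (Fin n)) : Prop :=
  ∀ φ : EuclideanSpace ℝ (Fin n) → EuclideanSpace ℝ (Fin n),
    ContDiff ℝ (⊤ : ℕ∞) φ → HasCompactSupport φ → (∀ x, divg φ x = 0) →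
    (∫ x, frob (DH h (symGrad u x)) (symGrad φ x)) = 0

/-- The open square Q_R(x₀) ⊂ ℝ². -/
def sqr (R : ℝ) (x₀ : EuclideanSpace ℝ (Fin 2)) : Set (EuclideanSpace ℝ (Fin 2)) :=
  {x | |x 0 - x₀ 0| < R ∧ |x 1 - x₀ 1| < R}

/-- h'(t)/t, extended by h''(0) at t = 0. -/
def slopeH (h : ℝ → ℝ) (t : ℝ) : ℝ :=
  if t = 0 then deriv (deriv h) 0 else deriv h t / t

abbrev E2 := EuclideanSpace ℝ (Fin 2)

open scoped Convolution ContDiff Topology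
open ContinuousLinearMap

lemma exists_mollify (φ : E2 → E2) (hφ : ContDiff ℝ 1 φ) (hc : HasCompactSupport φ)
    (hdiv : ∀ x, divg φ x = 0) :
    ∃ (Φ : ℕ → E2 → E2) (r S : ℝ),
      (∀ n, ContDiff ℝ (⊤ : ℕ∞) (Φ n)) ∧ (∀ n, HasCompactSupport (Φ n)) ∧
      (∀ n x, divg (Φ n) x = 0) ∧
      (∀ n x, ‖Φ n x‖ ≤ S) ∧ (∀ n x, ‖fderiv ℝ (Φ n) x‖ ≤ S) ∧
      (∀ n x, r < ‖x‖ → Φ n x = 0 ∧ fderiv ℝ (Φ n) x = 0) ∧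
      (∀ x, Tendsto (fun n => Φ n x) atTop (𝓝 (φ x))) ∧
      (∀ x, Tendsto (fun n => fderiv ℝ (Φ n) x) atTop (𝓝 (fderiv ℝ φ x))) := by
  obtain ⟨r, hr⟩ := hc.isCompact.isBounded.subset_closedBall (0 : E2)
  have hcf := hc.fderiv ℝ
  have hfc : Continuous (fderiv ℝ φ) := hφ.continuous_fderiv one_ne_zero
  obtain ⟨S1, hS1⟩ := hc.exists_bound_of_continuous hφ.continuous
  obtain ⟨S2, hS2⟩ := hcf.exists_bound_of_continuous hfc
  have hz : ∀ y, r < ‖y‖ → φ y = 0 ∧ fderiv ℝ φ y = 0 := by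
    intro y hy
    have hy' : y ∉ tsupport φ := fun h => by
      have := hr h
      simp at this
      linarith
    exact ⟨image_eq_zero_of_notMem_tsupport hy',
      image_eq_zero_of_notMem_tsupport fun h => hy' (tsupport_fderiv_subset ℝ h)⟩
  let b : ℕ → ContDiffBump (0 : E2) := fun n =>
    ⟨1 / (2 * ((n : ℝ) + 1)), 1 / ((n : ℝ) + 1), by positivity, by
      have : (0:ℝ) ≤ n := by positivity
      apply one_div_lt_one_div_of_lt (by positivity)
      linarith⟩
  have hb1 : ∀ n, (b n).rOut ≤ 1 := fun n => by
    change 1 / ((n : ℝ) + 1) ≤ 1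
    rw [div_le_one (by positivity)]
    have : (0:ℝ) ≤ n := by positivity
    linarith
  have hbt : Tendsto (fun n => (b n).rOut) atTop (𝓝 0) := tendsto_one_div_add_atTop_nhds_zero_nat
  let ρ : ℕ → E2 → ℝ := fun n => (b n).normed volume
  let Φ : ℕ → E2 → E2 := fun n => (ρ n ⋆[lsmul ℝ ℝ, volume] φ)
  let Ψ : ℕ → E2 → (E2 →L[ℝ] E2) := fun n => (ρ n ⋆[lsmul ℝ ℝ, volume] (fderiv ℝ φ))
  have hρl : ∀ n, LocallyIntegrable (ρ n) volume := fun n =>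
    (b n).continuous_normed.locallyIntegrable
  have hder : ∀ n x, HasFDerivAt (Φ n) (Ψ n x) x := by
    intro n x
    have := hc.hasFDerivAt_convolution_right (lsmul ℝ ℝ) (hρl n) hφ x
    have e : Ψ n x = (ρ n ⋆[precompR E2 (lsmul ℝ ℝ), volume] fderiv ℝ φ) x := by
      change (∫ t, _) = ∫ t, _
      refine integral_congr_ae (ae_of_all _ fun t => ?_)
      ext v
      rfl
    rw [e]
    exact this
  have hfd : ∀ n x, fderiv ℝ (Φ n) x = Ψ n x := fun n x => (hder n x).fderiv
  have key : ∀ {F : Type} [NormedAddCommGroup F] [NormedSpace ℝ F] [CompleteSpace F] (g : E2 → F) (C : ℝ) (n : ℕ) (x : E2),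
      Continuous g → 0 ≤ C → (∀ y ∈ Metric.ball x 1, ‖g y‖ ≤ C) → ‖(ρ n ⋆[lsmul ℝ ℝ, volume] g) x‖ ≤ C := by
    intro F _ _ _ g C n x hg hC h
    rw [← dist_zero_right]
    refine dist_convolution_le hC (b n).support_normed_eq.subset (b n).nonneg_normed (b n).integral_normed
      hg.aestronglyMeasurable ?_
    intro y hy
    rw [dist_zero_right]
    exact h y (Metric.ball_subset_ball (hb1 n) hy)
  have hΦz : ∀ n x, r + 1 < ‖x‖ → Φ n x = 0 ∧ Ψ n x = 0 := by
    intro n x hx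
    have : ∀ y ∈ Metric.ball x 1, r < ‖y‖ := by
      intro y hy
      rw [Metric.mem_ball, dist_eq_norm] at hy
      have := norm_sub_norm_le x y
      rw [norm_sub_rev] at this
      linarith
    constructor
    · exact norm_le_zero_iff.1 (key φ 0 n x hφ.continuous le_rfl fun y hy => by simp [(hz y (this y hy)).1])
    · exact norm_le_zero_iff.1 (key _ 0 n x hfc le_rfl fun y hy => by simp [(hz y (this y hy)).2])
  refine ⟨Φ, r + 1, max S1 S2, ?_, ?_, ?_, ?_, ?_, ?_, ?_, ?_⟩
  · intro n
    exact (b n).hasCompactSupport_normed.contDiff_convolution_left _ (b n).contDiff_normed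
      hφ.continuous.locallyIntegrable
  · intro n
    refine HasCompactSupport.of_support_subset_isCompact (isCompact_closedBall (0:E2) (r+1)) ?_
    intro x hx
    by_contra hx'
    simp at hx'
    exact hx (hΦz n x hx').1
  · intro n x
    let T : (E2 →L[ℝ] E2) →L[ℝ] ℝ := ∑ k : Fin 2,
      (EuclideanSpace.proj k).comp (ContinuousLinearMap.apply ℝ E2 (EuclideanSpace.single k (1:ℝ)))
    have hT : ∀ A, T A = ∑ k : Fin 2, A (EuclideanSpace.single k 1) k := by
      intro A; simp [T]
    have h1 : divg (Φ n) x = T (Ψ n x) := by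
      rw [hT]; simp only [divg, pd, hfd]
    rw [h1]
    have hex : ConvolutionExistsAt (ρ n) (fderiv ℝ φ) x (lsmul ℝ ℝ) volume :=
      hcf.convolutionExists_right _ (hρl n) hfc x
    change T (∫ t, (lsmul ℝ ℝ (ρ n t)) (fderiv ℝ φ (x - t))) = 0
    rw [← ContinuousLinearMap.integral_comp_comm _ hex]
    have : ∀ t, T ((lsmul ℝ ℝ (ρ n t)) (fderiv ℝ φ (x - t))) = 0 := by
      intro t
      have h2 := hdiv (x - t)
      simp only [divg, pd] at h2
      rw [lsmul_apply, map_smul, hT, h2, smul_zero]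
    simp only [this, integral_zero]
  · intro n x
    exact key φ _ n x hφ.continuous (le_max_of_le_left ((norm_nonneg _).trans (hS1 0))) fun y _ => (hS1 y).trans (le_max_left _ _)
  · intro n x
    rw [hfd]
    exact key _ _ n x hfc (le_max_of_le_left ((norm_nonneg _).trans (hS1 0))) fun y _ => (hS2 y).trans (le_max_right _ _)
  · intro n x hx
    rw [hfd]; exact hΦz n x hx
  · intro x
    exact ContDiffBump.convolution_tendsto_right_of_continuous hbt hφ.continuous x
  · intro x
    simp only [hfd]
    exact ContDiffBump.convolution_tendsto_right_of_continuous hbt hfc x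

lemma h_facts (h : ℝ → ℝ) (c₁ c₂ μ : ℝ)
    (hc₁ : 0 < c₁) (hc₂ : 0 < c₂)
    (hreg : ContDiff ℝ 2 h)
    (h0 : h 0 = 0) (h0' : deriv h 0 = 0)
    (hlow : ∀ t, 0 ≤ t →
      c₁ * (1 + t) ^ (-μ) ≤ min (deriv (deriv h) t) (slopeH h t))
    (hup : ∀ t, 0 ≤ t →
      max (deriv (deriv h) t) (slopeH h t) ≤ c₂ / (1 + t)) (t : ℝ) (ht : 0 ≤ t) :
    0 ≤ deriv h t ∧ deriv h t ≤ c₂ ∧ h t ≤ deriv h t * t := by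
  have hdiff : Differentiable ℝ h := hreg.differentiable (by norm_num)
  have hdc : ContDiff ℝ 1 (deriv h) := ((contDiff_succ_iff_deriv (n := 1)).1 (by norm_num; exact hreg)).2.2
  have hpos : ∀ s, 0 ≤ s → 0 ≤ deriv (deriv h) s := by
    intro s hs
    have h1 := hlow s hs
    have : 0 ≤ c₁ * (1 + s) ^ (-μ) := by positivity
    exact (this.trans h1).trans (min_le_left _ _)
  have hmono : MonotoneOn (deriv h) (Set.Ici 0) := by
    apply monotoneOn_of_deriv_nonneg (convex_Ici 0) hdc.continuous.continuousOn
      (hdc.differentiable one_ne_zero).differentiableOn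
    intro s hs
    rw [interior_Ici] at hs
    exact hpos s (le_of_lt hs)
  rcases ht.eq_or_lt with rfl | hlt
  · simp [h0, h0', hc₂.le]
  · have hnn : 0 ≤ deriv h t := by
      rw [← h0']
      exact hmono Set.self_mem_Ici ht ht
    refine ⟨hnn, ?_, ?_⟩
    · have h1 := (le_max_right _ _).trans (hup t ht)
      rw [slopeH, if_neg hlt.ne', div_le_div_iff₀ hlt (by linarith)] at h1
      nlinarith
    · obtain ⟨s, hs, hs'⟩ := exists_deriv_eq_slope h hlt hdiff.continuous.continuousOn hdiff.differentiableOn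
      rw [h0, sub_zero, sub_zero, eq_div_iff hlt.ne'] at hs'
      rw [← hs']
      exact mul_le_mul_of_nonneg_right (hmono (le_of_lt hs.1) ht hs.2.le) ht

lemma fnorm_nonneg' (A : Matrix (Fin 2) (Fin 2) ℝ) : 0 ≤ fnorm A := Real.sqrt_nonneg _

lemma frob_self_nonneg (A : Matrix (Fin 2) (Fin 2) ℝ) : 0 ≤ frob A A :=
  Finset.sum_nonneg fun _ _ => Finset.sum_nonneg fun _ _ => mul_self_nonneg _

lemma entry_le_fnorm (A : Matrix (Fin 2) (Fin 2) ℝ) (i j : Fin 2) : |A i j| ≤ fnorm A := by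
  apply Real.abs_le_sqrt
  rw [sq]
  exact (Finset.single_le_sum (f := fun j => A i j * A i j) (fun _ _ => mul_self_nonneg _) (Finset.mem_univ j)).trans
    (Finset.single_le_sum (f := fun i => ∑ j, A i j * A i j) (fun _ _ => Finset.sum_nonneg fun _ _ => mul_self_nonneg _) (Finset.mem_univ i))

lemma DH_apply (h : ℝ → ℝ) (A : Matrix (Fin 2) (Fin 2) ℝ) (i j : Fin 2) :
    DH h A i j = deriv h (fnorm A) / fnorm A * A i j := by
  unfold DH
  split_ifs with hA
  · simp [hA]
  · simp

lemma frob_DH (h : ℝ → ℝ) (A : Matrix (Fin 2) (Fin 2) ℝ) :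
    frob (DH h A) A = deriv h (fnorm A) * fnorm A := by
  have h1 : frob (DH h A) A = deriv h (fnorm A) / fnorm A * frob A A := by
    simp only [frob, DH_apply, Finset.mul_sum, mul_assoc]
  have h2 : frob A A = fnorm A * fnorm A := (Real.mul_self_sqrt (frob_self_nonneg A)).symm
  rw [h1, h2]
  by_cases hA : fnorm A = 0
  · simp [hA]
  · field_simp

lemma DH_bound (h : ℝ → ℝ) (c₂ : ℝ) (hb : ∀ t, 0 ≤ t → 0 ≤ deriv h t ∧ deriv h t ≤ c₂)
    (A : Matrix (Fin 2) (Fin 2) ℝ) (i j : Fin 2) : |DH h A i j| ≤ c₂ := by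
  have hf := fnorm_nonneg' A
  obtain ⟨h1, h2⟩ := hb _ hf
  rw [DH_apply, abs_mul, abs_of_nonneg (div_nonneg h1 hf)]
  by_cases hA : fnorm A = 0
  · simp [hA]; linarith
  · refine le_trans (mul_le_mul_of_nonneg_left (entry_le_fnorm A i j) (div_nonneg h1 hf)) ?_
    rw [div_mul_cancel₀ _ hA]
    exact h2

lemma pd_continuous {u : E2 → E2} (hu : ContDiff ℝ 1 u) (k i : Fin 2) :
    Continuous fun x => pd u k x i := by
  have : Continuous fun x => fderiv ℝ u x (EuclideanSpace.single k 1) :=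
    (hu.continuous_fderiv one_ne_zero).clm_apply continuous_const
  exact (EuclideanSpace.proj i : E2 →L[ℝ] ℝ).continuous.comp this

lemma comp_continuous {u : E2 → E2} (hu : Continuous u) (i : Fin 2) :
    Continuous fun x => u x i :=
  (EuclideanSpace.proj i : E2 →L[ℝ] ℝ).continuous.comp hu

lemma comp_le (v : E2) (i : Fin 2) : |v i| ≤ ‖v‖ := by
  simpa using PiLp.norm_apply_le v i

lemma pd_le (u : E2 → E2) (k i : Fin 2) (x : E2) : |pd u k x i| ≤ ‖fderiv ℝ u x‖ := by
  refine (comp_le _ i).trans ?_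
  unfold pd
  refine (ContinuousLinearMap.le_opNorm _ _).trans ?_
  simp

lemma symGrad_continuous {u : E2 → E2} (hu : ContDiff ℝ 1 u) (i j : Fin 2) :
    Continuous fun x => symGrad u x i j := by
  unfold symGrad
  exact ((pd_continuous hu _ _).add (pd_continuous hu _ _)).div_const 2

lemma fnorm_symGrad_continuous {u : E2 → E2} (hu : ContDiff ℝ 1 u) :
    Continuous fun x => fnorm (symGrad u x) := by
  unfold fnorm frob
  refine Continuous.sqrt ?_
  refine continuous_finsetSum _ fun i _ => continuous_finsetSum _ fun j _ => ?_
  exact (symGrad_continuous hu i j).mul (symGrad_continuous hu i j)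

lemma DH_measurable {h : ℝ → ℝ} {u : E2 → E2} (hu : ContDiff ℝ 1 u) (i j : Fin 2) :
    Measurable fun x => DH h (symGrad u x) i j := by
  simp only [DH_apply]
  have h1 := (fnorm_symGrad_continuous hu).measurable
  exact (((measurable_deriv h).comp h1).div h1).mul (symGrad_continuous hu i j).measurable

lemma frob_bound (c S : ℝ) (A B : Matrix (Fin 2) (Fin 2) ℝ) (hc : 0 ≤ c) (hA : ∀ i j, |A i j| ≤ c)
    (hB : ∀ i j, |B i j| ≤ S) : |frob A B| ≤ 4 * c * S := by
  have : ∀ i j, |A i j * B i j| ≤ c * S := fun i j => by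
    rw [abs_mul]; exact mul_le_mul (hA i j) (hB i j) (abs_nonneg _) hc
  have h00 := this 0 0
  have h01 := this 0 1
  have h10 := this 1 0
  have h11 := this 1 1
  simp only [frob, Fin.sum_univ_two]
  rw [abs_le] at *
  constructor <;> linarith

lemma weak_C1 {h : ℝ → ℝ} {c₂ : ℝ} (hb : ∀ t, 0 ≤ t → 0 ≤ deriv h t ∧ deriv h t ≤ c₂)
    {u : E2 → E2} (hu : ContDiff ℝ 1 u) (hw : IsWeakSolution h u)
    (φ : E2 → E2) (hφ : ContDiff ℝ 1 φ) (hc : HasCompactSupport φ) (hdiv : ∀ x, divg φ x = 0) :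
    Integrable (fun x => frob (DH h (symGrad u x)) (symGrad φ x)) ∧
    Integrable (fun x => ∑ k, ∑ i, u x k * pd u k x i * φ x i) ∧
    (∫ x, frob (DH h (symGrad u x)) (symGrad φ x)) +
      (∫ x, ∑ k, ∑ i, u x k * pd u k x i * φ x i) = 0 := by
  have hc2 : 0 ≤ c₂ := (hb 0 le_rfl).1.trans (hb 0 le_rfl).2
  obtain ⟨Φ, r, S, hΦ, hΦc, hΦd, hS1, hS2, hz, ht1, ht2⟩ := exists_mollify φ hφ hc hdiv
  have hS : 0 ≤ S := (norm_nonneg _).trans (hS1 0 0)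
  have hm1 : ∀ f : E2 → E2, ContDiff ℝ 1 f →
      Measurable (fun x => frob (DH h (symGrad u x)) (symGrad f x)) := by
    intro f hf
    unfold frob
    refine Finset.measurable_sum _ fun i _ => Finset.measurable_sum _ fun j _ => ?_
    exact (DH_measurable hu i j).mul (symGrad_continuous hf i j).measurable
  have hm2 : ∀ f : E2 → E2, ContDiff ℝ 1 f →
      Continuous (fun x => ∑ k, ∑ i, u x k * pd u k x i * f x i) := by
    intro f hf
    refine continuous_finsetSum _ fun i _ => continuous_finsetSum _ fun j _ => ?_
    exact ((comp_continuous hu.continuous _).mul (pd_continuous hu _ _)).mul (comp_continuous hf.continuous _)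
  have hΦ1 : ∀ n, ContDiff ℝ 1 (Φ n) := fun n => (hΦ n).of_le (by exact_mod_cast le_top)
  let B : E2 → ℝ := (Metric.closedBall (0:E2) r).indicator
    (fun x => (4 * c₂ + ∑ k, ∑ i, |u x k * pd u k x i|) * S)
  have hB : Integrable B := by
    apply IntegrableOn.integrable_indicator _ measurableSet_closedBall
    apply ContinuousOn.integrableOn_compact (isCompact_closedBall _ _)
    apply Continuous.continuousOn
    refine Continuous.mul (continuous_const.add ?_) continuous_const
    refine continuous_finsetSum _ fun i _ => continuous_finsetSum _ fun j _ => ?_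
    exact ((comp_continuous hu.continuous _).mul (pd_continuous hu _ _)).abs
  have hsum0 : ∀ x, 0 ≤ ∑ k, ∑ i, |u x k * pd u k x i| := fun x =>
    Finset.sum_nonneg fun _ _ => Finset.sum_nonneg fun _ _ => abs_nonneg _
  have hb1 : ∀ (f : E2 → E2), (∀ x, ‖fderiv ℝ f x‖ ≤ S) → (∀ x, r < ‖x‖ → fderiv ℝ f x = 0) →
      ∀ x, ‖frob (DH h (symGrad u x)) (symGrad f x)‖ ≤ B x := by
    intro f hf hf0 x
    by_cases hx : x ∈ Metric.closedBall (0:E2) r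
    · simp only [B, Set.indicator_of_mem hx]
      have h1 := frob_bound c₂ S (DH h (symGrad u x)) (symGrad f x) hc2
        (DH_bound h c₂ hb _) (fun i j => by
          have h1 := (pd_le f j i x).trans (hf x)
          have h2 := (pd_le f i j x).trans (hf x)
          simp only [symGrad]
          rw [abs_le] at *
          constructor <;> linarith)
      rw [Real.norm_eq_abs]
      nlinarith [mul_nonneg (hsum0 x) hS]
    · simp only [B, Set.indicator_of_notMem hx]
      have : fderiv ℝ f x = 0 := hf0 x (by simpa using hx)
      simp [frob, symGrad, pd, this]
  have hb2 : ∀ (f : E2 → E2), (∀ x, ‖f x‖ ≤ S) → (∀ x, r < ‖x‖ → f x = 0) →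
      ∀ x, ‖∑ k, ∑ i, u x k * pd u k x i * f x i‖ ≤ B x := by
    intro f hf hf0 x
    by_cases hx : x ∈ Metric.closedBall (0:E2) r
    · simp only [B, Set.indicator_of_mem hx]
      have h1 : ‖∑ k, ∑ i, u x k * pd u k x i * f x i‖ ≤ (∑ k, ∑ i, |u x k * pd u k x i|) * S := by
        rw [Finset.sum_mul]
        refine norm_sum_le_of_le _ fun k _ => ?_
        rw [Finset.sum_mul]
        refine norm_sum_le_of_le _ fun i _ => ?_
        rw [Real.norm_eq_abs, abs_mul]
        exact mul_le_mul_of_nonneg_left ((comp_le _ _).trans (hf x)) (abs_nonneg _)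
      have : 0 ≤ c₂ * S := by positivity
      linarith
    · simp only [B, Set.indicator_of_notMem hx]
      have : f x = 0 := hf0 x (by simpa using hx)
      simp [this]
  have hp : ∀ x k i, Tendsto (fun n => pd (Φ n) k x i) atTop (𝓝 (pd φ k x i)) := by
    intro x k i
    have h1 : Tendsto (fun n => fderiv ℝ (Φ n) x (EuclideanSpace.single k 1)) atTop
      (𝓝 (fderiv ℝ φ x (EuclideanSpace.single k 1))) :=
      ((ContinuousLinearMap.apply ℝ E2 (EuclideanSpace.single k (1:ℝ))).continuous.tendsto _).comp (ht2 x)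
    exact ((EuclideanSpace.proj i : E2 →L[ℝ] ℝ).continuous.tendsto _).comp h1
  have hq : ∀ x i, Tendsto (fun n => Φ n x i) atTop (𝓝 (φ x i)) := by
    intro x i
    exact ((EuclideanSpace.proj i : E2 →L[ℝ] ℝ).continuous.tendsto _).comp (ht1 x)
  have hl1 : ∀ x, Tendsto (fun n => frob (DH h (symGrad u x)) (symGrad (Φ n) x)) atTop
      (𝓝 (frob (DH h (symGrad u x)) (symGrad φ x))) := by
    intro x
    unfold frob
    refine tendsto_finsetSum _ fun i _ => tendsto_finsetSum _ fun j _ => ?_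
    exact (((hp x j i).add (hp x i j)).div_const 2).const_mul _
  have hl2 : ∀ x, Tendsto (fun n => ∑ k, ∑ i, u x k * pd u k x i * Φ n x i) atTop
      (𝓝 (∑ k, ∑ i, u x k * pd u k x i * φ x i)) := by
    intro x
    refine tendsto_finsetSum _ fun i _ => tendsto_finsetSum _ fun j _ => ?_
    exact (hq x j).const_mul _
  have hφS1 : ∀ x, ‖φ x‖ ≤ S := fun x => le_of_tendsto (ht1 x).norm (Eventually.of_forall fun n => hS1 n x)
  have hφS2 : ∀ x, ‖fderiv ℝ φ x‖ ≤ S := fun x => le_of_tendsto (ht2 x).norm (Eventually.of_forall fun n => hS2 n x)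
  have hφz : ∀ x, r < ‖x‖ → φ x = 0 ∧ fderiv ℝ φ x = 0 := by
    intro x hx
    have h1 := ht1 x
    have h2 := ht2 x
    simp only [(hz _ x hx).1] at h1
    simp only [(hz _ x hx).2] at h2
    exact ⟨tendsto_nhds_unique h1 tendsto_const_nhds, tendsto_nhds_unique h2 tendsto_const_nhds⟩
  refine ⟨hB.mono' (hm1 φ hφ).aestronglyMeasurable (ae_of_all _ (hb1 φ hφS2 fun x hx => (hφz x hx).2)),
    hB.mono' (hm2 φ hφ).aestronglyMeasurable (ae_of_all _ (hb2 φ hφS1 fun x hx => (hφz x hx).1)), ?_⟩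
  have L1 := tendsto_integral_of_dominated_convergence B
    (fun n => (hm1 (Φ n) (hΦ1 n)).aestronglyMeasurable) hB
    (fun n => ae_of_all _ (hb1 (Φ n) (hS2 n) fun x hx => (hz n x hx).2)) (ae_of_all volume hl1)
  have L2 := tendsto_integral_of_dominated_convergence B
    (fun n => (hm2 (Φ n) (hΦ1 n)).aestronglyMeasurable) hB
    (fun n => ae_of_all _ (hb2 (Φ n) (hS1 n) fun x hx => (hz n x hx).1)) (ae_of_all volume hl2)
  have L := L1.add L2
  refine tendsto_nhds_unique L ?_
  have : ∀ n, (∫ x, frob (DH h (symGrad u x)) (symGrad (Φ n) x)) +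
      (∫ x, ∑ k, ∑ i, u x k * pd u k x i * Φ n x i) = 0 := fun n => hw (Φ n) (hΦ n) (hΦc n) (hΦd n)
  simp only [this]
  exact tendsto_const_nhds

lemma hasFDerivAt_comp_coord {u : E2 → E2} (hu : ContDiff ℝ 1 u) (i : Fin 2) (x : E2) :
    HasFDerivAt (fun y => u y i) ((EuclideanSpace.proj i : E2 →L[ℝ] ℝ).comp (fderiv ℝ u x)) x :=
  (EuclideanSpace.proj i : E2 →L[ℝ] ℝ).hasFDerivAt.comp x
    (hu.differentiable one_ne_zero x).hasFDerivAt

lemma coord_contDiff {u : E2 → E2} (hu : ContDiff ℝ 1 u) (i : Fin 2) : ContDiff ℝ 1 (fun y => u y i) :=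
  (EuclideanSpace.proj i : E2 →L[ℝ] ℝ).contDiff.comp hu

lemma int_divfree {u : E2 → E2} (hu : ContDiff ℝ 1 u) (hd : ∀ x, divg u x = 0)
    (f : E2 → ℝ) (hf : ContDiff ℝ 1 f) (hc : HasCompactSupport f) :
    Integrable (fun x => ∑ k, u x k * fderiv ℝ f x (EuclideanSpace.single k 1)) ∧
    ∫ x, ∑ k, u x k * fderiv ℝ f x (EuclideanSpace.single k 1) = 0 := by
  have hfd : ∀ k : Fin 2, ∀ x, fderiv ℝ (fun y => u y k) x (EuclideanSpace.single k 1) = pd u k x k := by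
    intro k x
    rw [(hasFDerivAt_comp_coord hu k x).fderiv]
    rfl
  have hcf : ∀ k : Fin 2, Continuous fun x => fderiv ℝ f x (EuclideanSpace.single k 1) := fun k =>
    (hf.continuous_fderiv one_ne_zero).clm_apply continuous_const
  have i1 : ∀ k : Fin 2, Integrable (fun x => u x k * fderiv ℝ f x (EuclideanSpace.single k 1)) := fun k => by
    apply ((comp_continuous hu.continuous k).mul (hcf k)).integrable_of_hasCompactSupport
    exact (hc.fderiv_apply ℝ _).mul_left
  have i2 : ∀ k : Fin 2, Integrable (fun x => pd u k x k * f x) := fun k => by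
    apply ((pd_continuous hu k k).mul hf.continuous).integrable_of_hasCompactSupport
    exact hc.mul_left
  have i3 : ∀ k : Fin 2, Integrable (fun x => u x k * f x) := fun k => by
    apply ((comp_continuous hu.continuous k).mul hf.continuous).integrable_of_hasCompactSupport
    exact hc.mul_left
  refine ⟨integrable_finsetSum _ fun k _ => i1 k, ?_⟩
  rw [integral_finsetSum _ fun k _ => i1 k]
  have : ∀ k : Fin 2, ∫ x, u x k * fderiv ℝ f x (EuclideanSpace.single k 1) = - ∫ x, pd u k x k * f x := by
    intro k
    rw [integral_mul_fderiv_eq_neg_fderiv_mul_of_integrable (f := fun x => u x k) (by simpa only [hfd] using i2 k) (i1 k) (i3 k)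
      (fun x _ => (hasFDerivAt_comp_coord hu k x).differentiableAt)
      (fun x _ => hf.differentiable one_ne_zero x)]
    simp only [hfd]
  simp only [this]
  rw [Finset.sum_neg_distrib, ← integral_finsetSum _ fun k _ => i2 k]
  simp only [← Finset.sum_mul]
  have h2 : ∀ x, ∑ k, pd u k x k = 0 := hd
  simp [h2]

lemma exists_stream {u : E2 → E2} (hu : ContDiff ℝ 1 u) (hd : ∀ x, divg u x = 0) :
    ∃ ψ : E2 → ℝ, ∀ x, HasFDerivAt ψ (u x 0 • (EuclideanSpace.proj 1 : E2 →L[ℝ] ℝ) -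
      u x 1 • (EuclideanSpace.proj 0 : E2 →L[ℝ] ℝ)) x := by
  let om : E2 → E2 →L[ℝ] ℝ := fun x => u x 0 • (EuclideanSpace.proj 1 : E2 →L[ℝ] ℝ) -
      u x 1 • (EuclideanSpace.proj 0 : E2 →L[ℝ] ℝ)
  have hom : ∀ x, HasFDerivAt om (((EuclideanSpace.proj 0 : E2 →L[ℝ] ℝ).comp (fderiv ℝ u x)).smulRight
      (EuclideanSpace.proj 1 : E2 →L[ℝ] ℝ) - ((EuclideanSpace.proj 1 : E2 →L[ℝ] ℝ).comp (fderiv ℝ u x)).smulRight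
      (EuclideanSpace.proj 0 : E2 →L[ℝ] ℝ)) x := fun x =>
    ((hasFDerivAt_comp_coord hu 0 x).smul_const (EuclideanSpace.proj 1 : E2 →L[ℝ] ℝ)).sub ((hasFDerivAt_comp_coord hu 1 x).smul_const (EuclideanSpace.proj 0 : E2 →L[ℝ] ℝ))
  have dec : ∀ v : E2, v = v 0 • EuclideanSpace.single 0 (1:ℝ) + v 1 • EuclideanSpace.single 1 (1:ℝ) := by
    intro v; ext i; fin_cases i <;> simp
  obtain ⟨ψ, hψ⟩ := convex_univ.exists_forall_hasFDerivAt_of_fderiv_symmetric (s := (Set.univ : Set E2)) isOpen_univ 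
    (fun x _ => (hom x).differentiableAt.differentiableWithinAt) (by
      intro a _ x y
      rw [(hom a).fderiv]
      have h0 := hd a
      simp only [divg, Fin.sum_univ_two, pd] at h0
      have ex : ∀ i, fderiv ℝ u a x i = x 0 * fderiv ℝ u a (EuclideanSpace.single 0 1) i + x 1 * fderiv ℝ u a (EuclideanSpace.single 1 1) i := by
        intro i; conv_lhs => rw [dec x]
        simp
      have ey : ∀ i, fderiv ℝ u a y i = y 0 * fderiv ℝ u a (EuclideanSpace.single 0 1) i + y 1 * fderiv ℝ u a (EuclideanSpace.single 1 1) i := by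
        intro i; conv_lhs => rw [dec y]
        simp
      simp [ex, ey]
      linear_combination (x 0 * y 1 - x 1 * y 0) * h0)
  exact ⟨ψ, fun x => hψ x (Set.mem_univ _)⟩

lemma fderiv_scale (g : E2 → ℝ) (hg : Differentiable ℝ g) (R : ℝ) (x₀ x v : E2) :
    fderiv ℝ (fun y => g (R⁻¹ • (y - x₀))) x v = R⁻¹ * fderiv ℝ g (R⁻¹ • (x - x₀)) v := by
  have h1 : HasFDerivAt (fun y : E2 => R⁻¹ • (y - x₀)) (R⁻¹ • ContinuousLinearMap.id ℝ E2) x :=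
    ((hasFDerivAt_id x).sub_const x₀).const_smul R⁻¹
  have h2 := (hg (R⁻¹ • (x - x₀))).hasFDerivAt.comp x h1
  have h3 : fderiv ℝ (fun y => g (R⁻¹ • (y - x₀))) x = _ := h2.fderiv
  rw [h3]
  simp

lemma exists_cutoff : ∃ A : ℝ, 0 ≤ A ∧ ∀ (x₀ : E2) (R : ℝ), 0 < R → ∃ η : E2 → ℝ,
    ContDiff ℝ 2 η ∧ (∀ x, 0 ≤ η x) ∧ (∀ x ∈ sqr R x₀, η x = 1) ∧
    tsupport η ⊆ Metric.closedBall x₀ (3 * R) ∧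
    (∀ x (k : Fin 2), |fderiv ℝ η x (EuclideanSpace.single k 1)| ≤ A / R) ∧
    (∀ x (j k : Fin 2), |fderiv ℝ (fun y => fderiv ℝ η y (EuclideanSpace.single k 1)) x (EuclideanSpace.single j 1)| ≤ A / R ^ 2) := by
  let χ : ContDiffBump (0 : E2) := ⟨2, 3, by norm_num, by norm_num⟩
  have hχ : ContDiff ℝ 2 (χ : E2 → ℝ) := χ.contDiff
  have hχc : HasCompactSupport (χ : E2 → ℝ) := χ.hasCompactSupport
  have hd : ∀ k : Fin 2, ContDiff ℝ 1 (fun y => fderiv ℝ (χ : E2 → ℝ) y (EuclideanSpace.single k 1)) := fun k =>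
    (hχ.fderiv_right (m := 1) (by norm_num)).clm_apply contDiff_const
  have hb1 : ∀ k : Fin 2, ∃ C, ∀ y, ‖fderiv ℝ (χ : E2 → ℝ) y (EuclideanSpace.single k 1)‖ ≤ C := fun k =>
    (hχc.fderiv_apply ℝ _).exists_bound_of_continuous (hd k).continuous
  have hb2 : ∀ j k : Fin 2, ∃ C, ∀ y, ‖fderiv ℝ (fun y => fderiv ℝ (χ : E2 → ℝ) y (EuclideanSpace.single k 1)) y (EuclideanSpace.single j 1)‖ ≤ C := fun j k =>
    ((hχc.fderiv_apply ℝ _).fderiv_apply ℝ _).exists_bound_of_continuous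
      (((hd k).continuous_fderiv one_ne_zero).clm_apply continuous_const)
  choose C1 hC1 using hb1
  choose C2 hC2 using hb2
  have p1 : ∀ k, 0 ≤ C1 k := fun k => (norm_nonneg _).trans (hC1 k 0)
  have p2 : ∀ j k, 0 ≤ C2 j k := fun j k => (norm_nonneg _).trans (hC2 j k 0)
  have hA1 : ∀ k, C1 k ≤ ∑ k, C1 k + ∑ j, ∑ k, C2 j k := fun k => by
    have := Finset.single_le_sum (f := C1) (fun k _ => p1 k) (Finset.mem_univ k)
    have : 0 ≤ ∑ j, ∑ k, C2 j k := Finset.sum_nonneg fun _ _ => Finset.sum_nonneg fun _ _ => p2 _ _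
    linarith
  have hA2 : ∀ j k, C2 j k ≤ ∑ k, C1 k + ∑ j, ∑ k, C2 j k := fun j k => by
    have h1 := Finset.single_le_sum (f := C2 j) (fun k _ => p2 j k) (Finset.mem_univ k)
    have h2 := Finset.single_le_sum (f := fun j => ∑ k, C2 j k) (fun j _ => Finset.sum_nonneg fun _ _ => p2 _ _) (Finset.mem_univ j)
    have : 0 ≤ ∑ k, C1 k := Finset.sum_nonneg fun _ _ => p1 _
    linarith
  refine ⟨∑ k, C1 k + ∑ j, ∑ k, C2 j k, (p1 0).trans (hA1 0), ?_⟩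
  intro x₀ R hR
  have e1 : ∀ k : Fin 2, (fun y => fderiv ℝ (fun z => χ (R⁻¹ • (z - x₀))) y (EuclideanSpace.single k 1)) =
      fun y => R⁻¹ * fderiv ℝ (χ : E2 → ℝ) (R⁻¹ • (y - x₀)) (EuclideanSpace.single k 1) := by
    intro k; funext y; exact fderiv_scale _ (hχ.differentiable (by norm_num)) R x₀ y _
  refine ⟨fun y => χ (R⁻¹ • (y - x₀)), ?_, fun x => χ.nonneg, ?_, ?_, ?_, ?_⟩
  · exact hχ.comp (by fun_prop)
  · intro x hx
    apply χ.one_of_mem_closedBall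
    rw [mem_closedBall_zero_iff]
    change _ ≤ (2:ℝ)
    rw [norm_smul, norm_inv, Real.norm_eq_abs, abs_of_pos hR, inv_mul_le_iff₀ hR]
    rw [EuclideanSpace.norm_eq]
    apply Real.sqrt_le_iff.2
    refine ⟨by linarith, ?_⟩
    obtain ⟨ha, hb⟩ := hx
    simp only [Fin.sum_univ_two, PiLp.sub_apply, Real.norm_eq_abs, sq_abs]
    have h1 := sq_lt_sq' (abs_lt.1 ha).1 (abs_lt.1 ha).2
    have h2 := sq_lt_sq' (abs_lt.1 hb).1 (abs_lt.1 hb).2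
    nlinarith
  · apply closure_minimal _ Metric.isClosed_closedBall
    intro x hx
    by_contra hx'
    apply hx
    apply χ.zero_of_le_dist
    rw [dist_zero_right, norm_smul, norm_inv, Real.norm_eq_abs, abs_of_pos hR]
    change (3:ℝ) ≤ _
    rw [le_inv_mul_iff₀ hR]
    rw [Metric.mem_closedBall, dist_eq_norm] at hx'
    linarith
  · intro x k
    have := congrFun (e1 k) x
    rw [this, abs_mul, abs_inv, abs_of_pos hR, inv_mul_eq_div]
    exact div_le_div_of_nonneg_right ((hC1 k _).trans (hA1 k)) hR.le
  · intro x j k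
    rw [e1 k, fderiv_const_mul, smul_apply, fderiv_scale (fun y => fderiv ℝ (χ : E2 → ℝ) y (EuclideanSpace.single k 1)) ((hd k).differentiable one_ne_zero)]
    · rw [smul_eq_mul, ← mul_assoc, abs_mul, abs_mul, abs_inv, abs_of_pos hR, ← mul_inv, ← sq, inv_mul_eq_div]
      exact div_le_div_of_nonneg_right ((hC2 j k _).trans (hA2 j k)) (by positivity)
    · have : ContDiff ℝ 1 (fun y => fderiv ℝ (χ : E2 → ℝ) (R⁻¹ • (y - x₀)) (EuclideanSpace.single k 1)) :=
        (hd k).comp (by fun_prop)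
      exact this.differentiable one_ne_zero x

lemma pd_eq {f : E2 → E2} (hf : ContDiff ℝ 1 f) (k i : Fin 2) (x : E2) :
    pd f k x i = fderiv ℝ (fun y => f y i) x (EuclideanSpace.single k 1) := by
  rw [(hasFDerivAt_comp_coord hf i x).fderiv]; rfl

lemma fd_mul {p q : E2 → ℝ} (hp : ContDiff ℝ 1 p) (hq : ContDiff ℝ 1 q) (x v : E2) :
    fderiv ℝ (fun y => p y * q y) x v = p x * fderiv ℝ q x v + q x * fderiv ℝ p x v := by
  rw [fderiv_fun_mul (hp.differentiable one_ne_zero x) (hq.differentiable one_ne_zero x)]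
  simp

lemma fd_add {p q : E2 → ℝ} (hp : ContDiff ℝ 1 p) (hq : ContDiff ℝ 1 q) (x v : E2) :
    fderiv ℝ (fun y => p y + q y) x v = fderiv ℝ p x v + fderiv ℝ q x v := by
  rw [fderiv_fun_add (hp.differentiable one_ne_zero x) (hq.differentiable one_ne_zero x)]
  simp

lemma main_est {h : ℝ → ℝ} {c₂ : ℝ} (hreg : ContDiff ℝ 2 h)
    (hb : ∀ t, 0 ≤ t → 0 ≤ deriv h t ∧ deriv h t ≤ c₂)
    {u : E2 → E2} (hu : ContDiff ℝ 1 u) (hd : ∀ x, divg u x = 0) (hw : IsWeakSolution h u)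
    {M : ℝ} (hM : ∀ x, ‖u x‖ ≤ M) {A R : ℝ} (hA : 0 ≤ A) (hR : 0 < R) (x₀ : E2) (η : E2 → ℝ)
    (hη : ContDiff ℝ 2 η)
    (hηs : tsupport η ⊆ Metric.closedBall x₀ (3 * R))
    (hη1 : ∀ x (k : Fin 2), |fderiv ℝ η x (EuclideanSpace.single k 1)| ≤ A / R)
    (hη2 : ∀ x (j k : Fin 2), |fderiv ℝ (fun y => fderiv ℝ η y (EuclideanSpace.single k 1)) x (EuclideanSpace.single j 1)| ≤ A / R ^ 2) :
    Integrable (fun x => η x * (deriv h (fnorm (symGrad u x)) * fnorm (symGrad u x))) ∧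
    ∫ x, η x * (deriv h (fnorm (symGrad u x)) * fnorm (symGrad u x)) ≤
      (32 * c₂ * M + 30 * M ^ 3) * A * 9 * (volume : Measure E2).real (Metric.ball 0 1) * R := by
  have hM0 : 0 ≤ M := (norm_nonneg _).trans (hM 0)
  have hc2 : 0 ≤ c₂ := (hb 0 le_rfl).1.trans (hb 0 le_rfl).2
  have hη' : ContDiff ℝ 1 η := hη.of_le (by norm_num)
  obtain ⟨ψ, hψ⟩ := exists_stream hu hd
  have hcomp : ∀ x i, |u x i| ≤ M := fun x i => (comp_le _ _).trans (hM x)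
  -- derivatives of the cutoff
  obtain ⟨a, ha⟩ : ∃ a : Fin 2 → E2 → ℝ, ∀ k, a k = fun y => fderiv ℝ η y (EuclideanSpace.single k 1) := ⟨_, fun k => rfl⟩
  have ha' : ∀ k x, fderiv ℝ η x (EuclideanSpace.single k 1) = a k x := fun k x => by rw [ha]
  have haC : ∀ k, ContDiff ℝ 1 (a k) := fun k => by
    rw [ha]; exact (hη.fderiv_right (m := 1) (by norm_num)).clm_apply contDiff_const
  obtain ⟨s, hs⟩ : ∃ s : Fin 2 → Fin 2 → E2 → ℝ, ∀ j k x, fderiv ℝ (a k) x (EuclideanSpace.single j 1) = s j k x := ⟨_, fun j k x => rfl⟩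
  have hab : ∀ k x, |a k x| ≤ A / R := fun k x => by rw [← ha']; exact hη1 x k
  have hsb : ∀ j k x, |s j k x| ≤ A / R ^ 2 := fun j k x => by rw [← hs, ha]; exact hη2 x j k
  have hss : ∀ x, s 0 1 x = s 1 0 x := by
    intro x
    have hsym : IsSymmSndFDerivAt ℝ η x := hη.contDiffAt.isSymmSndFDerivAt (by simp)
    have hdd : DifferentiableAt ℝ (fderiv ℝ η) x :=
      (hη.fderiv_right (m := 1) (by norm_num)).differentiable one_ne_zero x
    have : ∀ j k, s j k x = fderiv ℝ (fderiv ℝ η) x (EuclideanSpace.single j 1) (EuclideanSpace.single k 1) := by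
      intro j k
      rw [← hs, ha, fderiv_clm_apply hdd (differentiableAt_const _)]
      simp
    rw [this, this]
    exact hsym _ _
  have hηz : ∀ x, x ∉ Metric.closedBall x₀ (3 * R) → η x = 0 ∧ (∀ k, a k x = 0) ∧ (∀ j k, s j k x = 0) := by
    intro x hx
    have h0 : x ∉ tsupport η := fun h => hx (hηs h)
    have h1 : ∀ k, tsupport (a k) ⊆ tsupport η := fun k => by
      rw [ha]; exact tsupport_fderiv_apply_subset ℝ _
    refine ⟨image_eq_zero_of_notMem_tsupport h0, fun k => image_eq_zero_of_notMem_tsupport fun h => h0 (h1 k h), fun j k => ?_⟩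
    rw [← hs]
    have := image_eq_zero_of_notMem_tsupport (f := fun y => fderiv ℝ (a k) y (EuclideanSpace.single j 1)) (x := x)
      fun h => h0 (h1 k (tsupport_fderiv_apply_subset ℝ _ h))
    exact this
  -- the stream function
  obtain ⟨g, hg⟩ : ∃ g : E2 → ℝ, g = fun x => ψ x - ψ x₀ := ⟨_, rfl⟩
  have hgd : ∀ x, HasFDerivAt g (u x 0 • (EuclideanSpace.proj 1 : E2 →L[ℝ] ℝ) -
      u x 1 • (EuclideanSpace.proj 0 : E2 →L[ℝ] ℝ)) x := fun x => by
    rw [hg]; exact (hψ x).sub_const _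
  have hgC : ContDiff ℝ 1 g := by
    rw [contDiff_one_iff_fderiv]
    refine ⟨fun x => (hgd x).differentiableAt, ?_⟩
    have : fderiv ℝ g = fun x => (u x 0 • (EuclideanSpace.proj 1 : E2 →L[ℝ] ℝ) -
      u x 1 • (EuclideanSpace.proj 0 : E2 →L[ℝ] ℝ)) := funext fun x => (hgd x).fderiv
    rw [this]
    exact ((comp_continuous hu.continuous 0).smul continuous_const).sub
      ((comp_continuous hu.continuous 1).smul continuous_const)
  have hg0 : ∀ x, fderiv ℝ g x (EuclideanSpace.single 0 1) = - u x 1 := fun x => by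
    rw [(hgd x).fderiv]; simp
  have hg1 : ∀ x, fderiv ℝ g x (EuclideanSpace.single 1 1) = u x 0 := fun x => by
    rw [(hgd x).fderiv]; simp
  have hgb : ∀ x ∈ Metric.closedBall x₀ (3 * R), |g x| ≤ 6 * M * R := by
    intro x hx
    have h1 : ∀ y, ‖fderiv ℝ g y‖ ≤ 2 * M := by
      intro y
      rw [(hgd y).fderiv]
      refine ContinuousLinearMap.opNorm_le_bound _ (by positivity) fun v => ?_
      simp only [sub_apply, smul_apply, EuclideanSpace.coe_proj, smul_eq_mul]
      refine (norm_sub_le _ _).trans ?_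
      rw [norm_mul, norm_mul]
      have e1 := mul_le_mul (hcomp y 0) (comp_le v 1) (abs_nonneg _) hM0
      have e2 := mul_le_mul (hcomp y 1) (comp_le v 0) (abs_nonneg _) hM0
      simp only [Real.norm_eq_abs]
      linarith
    have h2 := convex_univ.norm_image_sub_le_of_norm_fderiv_le (f := g) (𝕜 := ℝ) (C := 2 * M)
      (fun y _ => (hgd y).differentiableAt) (fun y _ => h1 y) (Set.mem_univ x₀) (Set.mem_univ x)
    have h3 : g x₀ = 0 := by simp [hg]
    rw [h3, sub_zero, Real.norm_eq_abs] at h2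
    rw [Metric.mem_closedBall, dist_eq_norm] at hx
    nlinarith
  -- the correction
  obtain ⟨w, hwdef⟩ : ∃ w : E2 → E2, w = fun x => !₂[g x * a 1 x, -1 * (g x * a 0 x)] := ⟨_, rfl⟩
  have hw0 : ∀ x, w x 0 = g x * a 1 x := fun x => by simp [hwdef]
  have hw1 : ∀ x, w x 1 = -1 * (g x * a 0 x) := fun x => by simp [hwdef]
  have hwC : ContDiff ℝ 1 w := by
    rw [contDiff_euclidean]
    intro i
    fin_cases i
    · simp only [Fin.zero_eta, hw0]; exact hgC.mul (haC 1)
    · simp only [Fin.mk_one, hw1]; exact contDiff_const.mul (hgC.mul (haC 0))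
  have hpw0 : ∀ j x, pd w j x 0 = g x * s j 1 x + a 1 x * fderiv ℝ g x (EuclideanSpace.single j 1) := by
    intro j x
    rw [pd_eq hwC]
    simp only [hw0]
    rw [fd_mul hgC (haC 1), hs]
  have hpw1 : ∀ j x, pd w j x 1 = -(g x * s j 0 x + a 0 x * fderiv ℝ g x (EuclideanSpace.single j 1)) := by
    intro j x
    rw [pd_eq hwC]
    simp only [hw1]
    rw [fd_mul contDiff_const (hgC.mul (haC 0)), fd_mul hgC (haC 0), hs]
    simp
  have hgdb : ∀ j x, |fderiv ℝ g x (EuclideanSpace.single j 1)| ≤ M := by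
    intro j x
    fin_cases j
    · simp only [Fin.zero_eta, hg0, abs_neg]; exact hcomp x 1
    · simp only [Fin.mk_one, hg1]; exact hcomp x 0
  have hpwb' : ∀ x ∈ Metric.closedBall x₀ (3 * R), ∀ j k, 
      |g x * s j k x + a k x * fderiv ℝ g x (EuclideanSpace.single j 1)| ≤ 7 * M * A / R := by
    intro x hx j k
    refine (abs_add_le _ _).trans ?_
    rw [abs_mul, abs_mul]
    have e1 := mul_le_mul (hgb x hx) (hsb j k x) (abs_nonneg _) (by positivity)
    have e2 := mul_le_mul (hab k x) (hgdb j x) (abs_nonneg _) (by positivity)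
    have e3 : 6 * M * R * (A / R ^ 2) + A / R * M = 7 * M * A / R := by field_simp; ring
    linarith
  have hpwb : ∀ x ∈ Metric.closedBall x₀ (3 * R), ∀ j i, |pd w j x i| ≤ 7 * M * A / R := by
    intro x hx j i
    fin_cases i
    · simp only [Fin.zero_eta, hpw0]; exact hpwb' x hx j 1
    · simp only [Fin.mk_one, hpw1, abs_neg]; exact hpwb' x hx j 0
  have hwz : ∀ x, x ∉ Metric.closedBall x₀ (3 * R) → w x = 0 ∧ ∀ j i, pd w j x i = 0 := by
    intro x hx
    obtain ⟨-, h1, h2⟩ := hηz x hx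
    constructor
    · ext i; fin_cases i
      · simp [hw0, h1]
      · simp [hw1, h1]
    · intro j i
      fin_cases i
      · simp [hpw0, h1, h2]
      · simp [hpw1, h1, h2]
  -- the test function
  obtain ⟨φ, hφdef⟩ : ∃ φ : E2 → E2, φ = fun x => η x • u x + w x := ⟨_, rfl⟩
  have hφi : ∀ x i, φ x i = η x * u x i + w x i := fun x i => by simp [hφdef]
  have hφC : ContDiff ℝ 1 φ := by rw [hφdef]; exact (hη'.smul hu).add hwC
  have hφc : HasCompactSupport φ := by
    refine HasCompactSupport.of_support_subset_isCompact (isCompact_closedBall x₀ (3 * R)) ?_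
    intro x hx
    by_contra hx'
    apply hx
    simp [hφdef, (hηz x hx').1, (hwz x hx').1]
  have hpφ : ∀ j x i, pd φ j x i = η x * pd u j x i + u x i * a j x + pd w j x i := by
    intro j x i
    rw [pd_eq hφC, pd_eq hwC, pd_eq hu]
    simp only [hφi]
    rw [fd_add (hη'.mul (coord_contDiff hu i)) (coord_contDiff hwC i), fd_mul hη' (coord_contDiff hu i), ha']
  have hφd : ∀ x, divg φ x = 0 := by
    intro x
    have h1 := hd x
    simp only [divg, Fin.sum_univ_two] at h1 ⊢
    simp only [hpφ, hpw0, hpw1, hg0, hg1]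
    linear_combination η x * h1 + g x * hss x
  obtain ⟨I1, I2, I3⟩ := weak_C1 hb hu hw φ hφC hφc hφd
  -- the convective term
  obtain ⟨f, hf⟩ : ∃ f : E2 → ℝ, f = fun y => η y * (1 / 2 * (u y 0 * u y 0 + u y 1 * u y 1)) + (u y 0 * w y 0 + u y 1 * w y 1) := ⟨_, rfl⟩
  have U := coord_contDiff hu
  have W := coord_contDiff hwC
  have hfC : ContDiff ℝ 1 f := by
    rw [hf]
    exact (hη'.mul (contDiff_const.mul (((U 0).mul (U 0)).add ((U 1).mul (U 1))))).add
      (((U 0).mul (W 0)).add ((U 1).mul (W 1)))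
  have hfc : HasCompactSupport f := by
    refine HasCompactSupport.of_support_subset_isCompact (isCompact_closedBall x₀ (3 * R)) ?_
    intro x hx
    by_contra hx'
    apply hx
    simp [hf, (hηz x hx').1, (hwz x hx').1]
  have hfd : ∀ k x, fderiv ℝ f x (EuclideanSpace.single k 1) =
      1 / 2 * (u x 0 * u x 0 + u x 1 * u x 1) * a k x + η x * (u x 0 * pd u k x 0 + u x 1 * pd u k x 1)
      + (u x 0 * pd w k x 0 + w x 0 * pd u k x 0 + u x 1 * pd w k x 1 + w x 1 * pd u k x 1) := by
    intro k x
    rw [hf]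
    rw [fd_add (hη'.mul (contDiff_const.mul (((U 0).mul (U 0)).add ((U 1).mul (U 1)))))
      (((U 0).mul (W 0)).add ((U 1).mul (W 1))),
      fd_mul hη' (contDiff_const.mul (((U 0).mul (U 0)).add ((U 1).mul (U 1)))),
      fd_mul contDiff_const (((U 0).mul (U 0)).add ((U 1).mul (U 1))),
      fd_add ((U 0).mul (U 0)) ((U 1).mul (U 1)), fd_mul (U 0) (U 0), fd_mul (U 1) (U 1),
      fd_add ((U 0).mul (W 0)) ((U 1).mul (W 1)), fd_mul (U 0) (W 0), fd_mul (U 1) (W 1), ha',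
      ← pd_eq hu, ← pd_eq hu, ← pd_eq hwC, ← pd_eq hwC]
    simp
    ring
  obtain ⟨J1, J2⟩ := int_divfree hu hd f hfC hfc
  -- pointwise identity
  let Er : E2 → Matrix (Fin 2) (Fin 2) ℝ := fun x i j => (u x i * a j x + pd w j x i + (u x j * a i x + pd w i x j)) / 2
  let Cr : E2 → ℝ := fun x => (∑ k, u x k * (1 / 2 * (u x 0 * u x 0 + u x 1 * u x 1) * a k x)) + ∑ k, ∑ i, u x k * (u x i * pd w k x i)
  have hT1 : ∀ x, frob (DH h (symGrad u x)) (symGrad φ x) =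
      η x * (deriv h (fnorm (symGrad u x)) * fnorm (symGrad u x)) + frob (DH h (symGrad u x)) (Er x) := by
    intro x
    rw [← frob_DH]
    simp only [frob, Fin.sum_univ_two]
    have : ∀ i j, symGrad φ x i j = η x * symGrad u x i j + Er x i j := by
      intro i j
      simp only [symGrad, hpφ, Er]
      ring
    simp only [this]
    ring
  have hT2 : ∀ x, (∑ k, ∑ i, u x k * pd u k x i * φ x i) -
      ∑ k, u x k * fderiv ℝ f x (EuclideanSpace.single k 1) = - Cr x := by
    intro x
    simp only [hfd, hφi, Cr, Fin.sum_univ_two]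
    ring
  set K := (32 * c₂ * M + 30 * M ^ 3) * A with hK
  let Bd : E2 → ℝ := (Metric.closedBall x₀ (3 * R)).indicator (fun _ => K / R)
  have hpt : ∀ x, η x * (deriv h (fnorm (symGrad u x)) * fnorm (symGrad u x)) ≤
      frob (DH h (symGrad u x)) (symGrad φ x) + (∑ k, ∑ i, u x k * pd u k x i * φ x i) -
      (∑ k, u x k * fderiv ℝ f x (EuclideanSpace.single k 1)) + Bd x := by
    intro x
    have e1 := hT1 x
    have e2 := hT2 x
    suffices Cr x - frob (DH h (symGrad u x)) (Er x) ≤ Bd x by linarith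
    by_cases hx : x ∈ Metric.closedBall x₀ (3 * R)
    · simp only [Bd, Set.indicator_of_mem hx]
      have hua : ∀ i j, |u x i * a j x| ≤ M * (A / R) := fun i j => by
        rw [abs_mul]; exact mul_le_mul (hcomp x i) (hab j x) (abs_nonneg _) hM0
      have f1 : |frob (DH h (symGrad u x)) (Er x)| ≤ 4 * c₂ * (8 * M * A / R) := by
        refine frob_bound _ _ _ _ hc2 (DH_bound h c₂ hb _) fun i j => ?_
        have g1 := hpwb x hx j i
        have g2 := hpwb x hx i j
        have g3 := hua i j
        have g4 := hua j i
        have g5 : 8 * M * A / R = M * (A / R) + 7 * M * A / R := by ring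
        rw [g5]
        simp only [Er]
        rw [abs_le] at *
        constructor <;> linarith
      have huu : |1 / 2 * (u x 0 * u x 0 + u x 1 * u x 1)| ≤ M ^ 2 := by
        have g1 := sq_le_sq' (abs_le.1 (hcomp x 0)).1 (abs_le.1 (hcomp x 0)).2
        have g2 := sq_le_sq' (abs_le.1 (hcomp x 1)).1 (abs_le.1 (hcomp x 1)).2
        rw [abs_of_nonneg (mul_nonneg (by norm_num) (add_nonneg (mul_self_nonneg _) (mul_self_nonneg _)))]
        nlinarith
      have f2 : ∀ k, u x k * (1 / 2 * (u x 0 * u x 0 + u x 1 * u x 1) * a k x) ≤ M * (M ^ 2 * (A / R)) := by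
        intro k
        refine (le_abs_self _).trans ?_
        rw [abs_mul, abs_mul]
        refine mul_le_mul (hcomp x k) (mul_le_mul huu (hab k x) (abs_nonneg _) (by positivity)) (by positivity) hM0
      have f3 : ∀ k i, u x k * (u x i * pd w k x i) ≤ M * (M * (7 * M * A / R)) := by
        intro k i
        refine (le_abs_self _).trans ?_
        rw [abs_mul, abs_mul]
        exact mul_le_mul (hcomp x k) (mul_le_mul (hcomp x i) (hpwb x hx k i) (abs_nonneg _) hM0) (by positivity) hM0
      have f4 : K / R = 2 * (M * (M ^ 2 * (A / R))) + 4 * (M * (M * (7 * M * A / R))) + 4 * c₂ * (8 * M * A / R) := by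
        rw [hK]; ring
      rw [f4]
      simp only [Cr, Fin.sum_univ_two]
      have f5 := (abs_le.1 f1).1
      have := f2 0
      have := f2 1
      have := f3 0 0
      have := f3 0 1
      have := f3 1 0
      have := f3 1 1
      linarith
    · simp only [Bd, Set.indicator_of_notMem hx]
      obtain ⟨z1, z2, z3⟩ := hηz x hx
      obtain ⟨z4, z5⟩ := hwz x hx
      simp [Cr, Er, frob, z2, z5]
  have hBi : Integrable Bd := by
    apply IntegrableOn.integrable_indicator _ measurableSet_closedBall
    exact continuousOn_const.integrableOn_compact (isCompact_closedBall _ _)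
  have hXi : Integrable (fun x => η x * (deriv h (fnorm (symGrad u x)) * fnorm (symGrad u x))) := by
    have hdc : Continuous (deriv h) := hreg.continuous_deriv (by norm_num)
    have hfn := fnorm_symGrad_continuous hu
    apply (hη.continuous.mul ((hdc.comp hfn).mul hfn)).integrable_of_hasCompactSupport
    refine HasCompactSupport.of_support_subset_isCompact (isCompact_closedBall x₀ (3 * R)) ?_
    intro x hx
    by_contra hx'
    apply hx
    simp [(hηz x hx').1]
  refine ⟨hXi, ?_⟩
  refine (integral_mono hXi (((I1.add I2).sub J1).add hBi) hpt).trans ?_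
  rw [integral_add' ((I1.add I2).sub J1) hBi, integral_sub' (I1.add I2) J1, integral_add' I1 I2, I3, J2]
  rw [integral_indicator measurableSet_closedBall, setIntegral_const, 
    Measure.addHaar_real_closedBall _ _ (by positivity)]
  simp only [finrank_euclideanSpace_fin, smul_eq_mul]
  apply le_of_eq
  field_simp
  ring

/-- Lemma 1 of the paper: Caccioppoli-type estimate with linear growth.
For a μ-elliptic potential h (μ ∈ (1,∞)) and any bound M on the solution, there is a
constant c (depending only on M, h, c₁, c₂, μ) such that for every bounded divergence-free
weak solution u with sup|u| ≤ M, ∫_{Q_R(x₀)} h(|ε(u)|) dx ≤ c·R for all squares. -/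
theorem caccioppoli_linear_growth
    (h : ℝ → ℝ) (c₁ c₂ μ : ℝ)
    (hc₁ : 0 < c₁) (hc₂ : 0 < c₂) (hμ₁ : 1 < μ)
    (hreg : ContDiff ℝ 2 h)
    (hnonneg : ∀ t, 0 ≤ t → 0 ≤ h t)
    (h0 : h 0 = 0) (h0' : deriv h 0 = 0)
    (hlow : ∀ t, 0 ≤ t →
      c₁ * (1 + t) ^ (-μ) ≤ min (deriv (deriv h) t) (slopeH h t))
    (hup : ∀ t, 0 ≤ t →
      max (deriv (deriv h) t) (slopeH h t) ≤ c₂ / (1 + t))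
    (M : ℝ) (hM : 0 ≤ M) :
    ∃ c : ℝ, ∀ u : EuclideanSpace ℝ (Fin 2) → EuclideanSpace ℝ (Fin 2),
      ContDiff ℝ 1 u → (∀ x, divg u x = 0) → IsWeakSolution h u →
      (∀ x, ‖u x‖ ≤ M) →
      ∀ (x₀ : EuclideanSpace ℝ (Fin 2)) (R : ℝ), 0 < R →
        (∫⁻ x in sqr R x₀, ENNReal.ofReal (h (fnorm (symGrad u x)))) ≤
          ENNReal.ofReal (c * R) := by
  obtain ⟨A, hA, hcut⟩ := exists_cutoff
  have hf := h_facts h c₁ c₂ μ hc₁ hc₂ hreg h0 h0' hlow hup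
  have hb : ∀ t, 0 ≤ t → 0 ≤ deriv h t ∧ deriv h t ≤ c₂ := fun t ht => ⟨(hf t ht).1, (hf t ht).2.1⟩
  refine ⟨(32 * c₂ * M + 30 * M ^ 3) * A * 9 * (volume : Measure E2).real (Metric.ball 0 1), ?_⟩
  intro u hu hd hw hMu x₀ R hR
  obtain ⟨η, hη, hη0, hη1, hηs, hb1, hb2⟩ := hcut x₀ R hR
  obtain ⟨hi, hle⟩ := main_est hreg hb hu hd hw hMu hA hR x₀ η hη hηs hb1 hb2
  have hX : ∀ x, 0 ≤ deriv h (fnorm (symGrad u x)) * fnorm (symGrad u x) := fun x =>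
    mul_nonneg (hb _ (fnorm_nonneg' _)).1 (fnorm_nonneg' _)
  have hms : MeasurableSet (sqr R x₀) := by
    have c0 : Continuous fun x : E2 => |x 0 - x₀ 0| := ((comp_continuous continuous_id 0).sub continuous_const).abs
    have c1 : Continuous fun x : E2 => |x 1 - x₀ 1| := ((comp_continuous continuous_id 1).sub continuous_const).abs
    exact ((isOpen_lt c0 continuous_const).inter (isOpen_lt c1 continuous_const)).measurableSet
  calc (∫⁻ x in sqr R x₀, ENNReal.ofReal (h (fnorm (symGrad u x))))
      ≤ ∫⁻ x in sqr R x₀, ENNReal.ofReal (η x * (deriv h (fnorm (symGrad u x)) * fnorm (symGrad u x))) := by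
        refine setLIntegral_mono' hms fun x hx => ENNReal.ofReal_le_ofReal ?_
        rw [hη1 x hx, one_mul]
        exact (hf _ (fnorm_nonneg' _)).2.2
    _ ≤ ∫⁻ x, ENNReal.ofReal (η x * (deriv h (fnorm (symGrad u x)) * fnorm (symGrad u x))) :=
        setLIntegral_le_lintegral _ _
    _ = ENNReal.ofReal (∫ x, η x * (deriv h (fnorm (symGrad u x)) * fnorm (symGrad u x))) :=
        (ofReal_integral_eq_lintegral_ofReal hi (ae_of_all _ fun x => mul_nonneg (hη0 x) (hX x))).symm
    _ ≤ _ := ENNReal.ofReal_le_ofReal hle
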